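/- Let C ⊆ ℝ^p be a nonempty closed convex cone with C ≠ ℝ^p, and define φ : ℝ^p → ℝ by φ(y) := dist(y, ℝ^p ∖ C) − dist(y, C). Then for all y_1, y_2 ∈ ℝ^p: if y_2 − y_1 ∈ C then φ(y_1) ≤ φ(y_2), and if y_2 − y_1 lies in the interior of C then φ(y_1) < φ(y_2). -/

import Mathlib

open Metric Set

section ConeDistance

variable {E : Type*} [NormedAddCommGroup E] {C : Set E}

theorem Metric.infDist_add_le_of_add_mem (hadd : ∀ a ∈ C, ∀ b ∈ C, a + b ∈ C)
    (hne : C.Nonempty) {k : E} (hk : k ∈ C) (y : E) :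
    infDist (y + k) C ≤ infDist y C := by
  refine (le_infDist hne).2 fun {c} hc => ?_
  simpa using infDist_le_dist_of_mem (x := y + k) (hadd c hc k hk)

theorem Metric.infDist_compl_le_add_of_add_mem (hadd : ∀ a ∈ C, ∀ b ∈ C, a + b ∈ C)
    (hne : Cᶜ.Nonempty) {k : E} (hk : k ∈ C) (y : E) :
    infDist y Cᶜ ≤ infDist (y + k) Cᶜ := by
  refine (le_infDist hne).2 fun {z} hz => ?_
  have hz' : z - k ∈ Cᶜ := fun h => hz (by simpa using hadd _ h k hk)
  refine (infDist_le_dist_of_mem hz').trans_eq ?_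
  rw [dist_eq_norm, dist_eq_norm]
  congr 1
  abel

variable [NormedSpace ℝ E]

theorem Convex.add_mem_of_smul_mem (hconv : Convex ℝ C)
    (hcone : ∀ c ∈ C, ∀ a : ℝ, 0 ≤ a → a • c ∈ C) {a b : E} (ha : a ∈ C) (hb : b ∈ C) :
    a + b ∈ C := by
  have h := hconv (hcone a ha 2 (by norm_num)) (hcone b hb 2 (by norm_num))
    (show (0 : ℝ) ≤ 1 / 2 by norm_num) (show (0 : ℝ) ≤ 1 / 2 by norm_num) (by norm_num)
  simpa [smul_smul] using h

/-- Translating a point of `C` by the centre of a ball of radius `ε` contained in `C` increases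
the distance to the complement by at least `ε`. -/
theorem Metric.infDist_compl_add_le_of_closedBall_subset (hadd : ∀ a ∈ C, ∀ b ∈ C, a + b ∈ C)
    (hne : Cᶜ.Nonempty) {k y : E} {ε : ℝ} (hε : 0 < ε) (hk : closedBall k ε ⊆ C) (hy : y ∈ C) :
    infDist y Cᶜ + ε ≤ infDist (y + k) Cᶜ := by
  refine (le_infDist hne).2 fun {z} hz => ?_
  rw [dist_eq_norm]
  set v := y + k - z with hv
  have hεv : ε < ‖v‖ := by
    by_contra! h
    refine hz ?_
    have : k - v ∈ C := hk (by simpa [mem_closedBall, dist_eq_norm] using h)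
    have h2 := hadd y hy _ this
    rwa [show y + (k - v) = z by rw [hv]; abel] at h2
  have hv0 : 0 < ‖v‖ := hε.trans hεv
  set t := ε / ‖v‖ with ht
  have htv : t * ‖v‖ = ε := div_mul_cancel₀ _ hv0.ne'
  have ht0 : 0 ≤ t := by positivity
  have ht1 : t ≤ 1 := (div_le_one hv0).2 hεv.le
  have hkt : k - t • v ∈ C := hk (by
    simp [mem_closedBall, norm_smul, abs_of_nonneg ht0, htv])
  have hz' : z - (k - t • v) ∈ Cᶜ := fun h => hz (by simpa using hadd _ h _ hkt)
  have h := infDist_le_dist_of_mem (x := y) hz'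
  rw [dist_eq_norm, show y - (z - (k - t • v)) = (1 - t) • v by rw [sub_smul, one_smul, hv]; abel,
    norm_smul, Real.norm_of_nonneg (by linarith)] at h
  linarith

/-- Translating a point outside a closed set `C` by an interior point of `C` strictly decreases
the distance to `C`. -/
theorem Metric.infDist_add_lt_of_closedBall_subset [ProperSpace E]
    (hadd : ∀ a ∈ C, ∀ b ∈ C, a + b ∈ C) (hcl : IsClosed C) (hne : C.Nonempty)
    {k y : E} {ε : ℝ} (hε : 0 < ε) (hk : closedBall k ε ⊆ C) (hy : y ∉ C) :
    infDist (y + k) C < infDist y C := by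
  obtain ⟨c, hc, hyc⟩ := hcl.exists_infDist_eq_dist hne y
  rw [hyc, dist_eq_norm]
  set v := y - c with hv
  have hv0 : 0 < ‖v‖ := norm_pos_iff.2 (sub_ne_zero.2 fun h => hy (h ▸ hc))
  set t := min 1 (ε / ‖v‖) with ht
  have ht0 : 0 < t := lt_min one_pos (by positivity)
  have ht1 : t ≤ 1 := min_le_left _ _
  have htv : t * ‖v‖ ≤ ε := (le_div_iff₀ hv0).1 (min_le_right _ _)
  have hkt : k + t • v ∈ C := hk (by
    simpa [mem_closedBall, dist_eq_norm, norm_smul, abs_of_pos ht0] using htv)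
  have h := infDist_le_dist_of_mem (x := y + k) (hadd c hc _ hkt)
  rw [dist_eq_norm, show y + k - (c + (k + t • v)) = (1 - t) • v by
    rw [sub_smul, one_smul, hv]; abel, norm_smul, Real.norm_of_nonneg (by linarith)] at h
  nlinarith

end ConeDistance

/-- For a nonempty closed convex cone C ⊊ ℝ^p and
φ(y) := dist(y, ℝ^p ∖ C) − dist(y, C): y₂ − y₁ ∈ C implies φ(y₁) ≤ φ(y₂),
and y₂ − y₁ ∈ int C implies φ(y₁) < φ(y₂). -/
theorem stmt_7 (p : ℕ) (C : Set (EuclideanSpace ℝ (Fin p)))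
    (hne : C.Nonempty) (hcl : IsClosed C) (hconv : Convex ℝ C)
    (hcone : ∀ c ∈ C, ∀ a : ℝ, 0 ≤ a → a • c ∈ C)
    (hCne : C ≠ Set.univ)
    (φ : EuclideanSpace ℝ (Fin p) → ℝ)
    (hφ : ∀ y, φ y = Metric.infDist y Cᶜ - Metric.infDist y C) :
    ∀ y₁ y₂ : EuclideanSpace ℝ (Fin p),
      (y₂ - y₁ ∈ C → φ y₁ ≤ φ y₂) ∧
      (y₂ - y₁ ∈ interior C → φ y₁ < φ y₂) := by
  intro y₁ y₂
  have hadd : ∀ a ∈ C, ∀ b ∈ C, a + b ∈ C := fun a ha b hb =>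
    hconv.add_mem_of_smul_mem hcone ha hb
  have hne' : Cᶜ.Nonempty := nonempty_compl.2 hCne
  obtain ⟨k, rfl⟩ : ∃ k, y₂ = y₁ + k := ⟨y₂ - y₁, by abel⟩
  rw [add_sub_cancel_left, hφ, hφ]
  refine ⟨fun hk => sub_le_sub (infDist_compl_le_add_of_add_mem hadd hne' hk y₁)
    (infDist_add_le_of_add_mem hadd hne hk y₁), fun hk => ?_⟩
  obtain ⟨ε, hε, hball⟩ := nhds_basis_closedBall.mem_iff.1 (mem_interior_iff_mem_nhds.1 hk)
  have h1 := infDist_compl_le_add_of_add_mem hadd hne' (interior_subset hk) y₁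
  have h2 := infDist_add_le_of_add_mem hadd hne (interior_subset hk) y₁
  by_cases hy : y₁ ∈ C
  · linarith [infDist_compl_add_le_of_closedBall_subset hadd hne' hε hball hy]
  · linarith [infDist_add_lt_of_closedBall_subset hadd hcl hne hε hball hy]
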